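/- Let n ≥ 1, let V be a real vector space of dimension 4n, and let Ω : V × V → ℂ be an ℝ-bilinear alternating complex-valued form satisfying Ω^(n+1) = 0 and Ω^n ∧ conj(Ω)^n ≠ 0. Write Ω = ω₁ + i·ω₂ where ω₁ and ω₂ are real-valued alternating bilinear forms on V. Then both ω₁ and ω₂ are nondegenerate, i.e. for each of them, the only v ∈ V pairing to zero with every w ∈ V is v = 0. -/

import Mathlib

open Module

/-- The wedge product `F 0 ∧ F 1 ∧ ⋯ ∧ F (m-1)` of a family of complex-valued 2-forms on `V`,
as an (unnormalized) alternating `2m`-linear map: the signed sum over all permutations of the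
products of the values of the `F i` on consecutive pairs of arguments. (This differs from the
usual wedge product only by the nonzero constant `2^m · m!`.) -/
noncomputable def wedgePow {V : Type*} (m : ℕ) (F : Fin m → V → V → ℂ)
    (v : Fin (2 * m) → V) : ℂ :=
  ∑ σ : Equiv.Perm (Fin (2 * m)), ((Equiv.Perm.sign σ : ℤ) : ℂ) *
    ∏ i : Fin m, F i (v (σ ⟨2 * (i : ℕ), by omega⟩)) (v (σ ⟨2 * (i : ℕ) + 1, by omega⟩))

theorem exists_linearMap_prod_update {R V : Type*} [CommRing R] [Algebra R ℂ] [AddCommGroup V]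
    [Module R V] (m : ℕ) (F : Fin m → V →ₗ[R] V →ₗ[R] ℂ) [DecidableEq (Fin (2 * m))]
    (v : Fin (2 * m) → V) (k : Fin (2 * m)) :
    ∃ L : V →ₗ[R] ℂ, ∀ z, ∏ i : Fin m, F i (Function.update v k z ⟨2 * (i : ℕ), by omega⟩)
      (Function.update v k z ⟨2 * (i : ℕ) + 1, by omega⟩) = L z := by
  have hk : (k : ℕ) / 2 < m := by omega
  let C : ℂ := ∏ i ∈ Finset.univ.erase ⟨(k : ℕ) / 2, hk⟩,
    F i (v ⟨2 * (i : ℕ), by omega⟩) (v ⟨2 * (i : ℕ) + 1, by omega⟩)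
  suffices h : ∃ L : V →ₗ[R] ℂ, ∀ z,
      F ⟨(k : ℕ) / 2, hk⟩ (Function.update v k z ⟨2 * ((k : ℕ) / 2), by omega⟩)
        (Function.update v k z ⟨2 * ((k : ℕ) / 2) + 1, by omega⟩) = L z by
    obtain ⟨L, hL⟩ := h
    refine ⟨(LinearMap.mulRight R C).comp L, fun z => ?_⟩
    rw [← Finset.mul_prod_erase _ _ (Finset.mem_univ ⟨(k : ℕ) / 2, hk⟩), hL]
    refine congrArg (L z * ·) (Finset.prod_congr rfl fun i hi => ?_)
    have hne : (i : ℕ) ≠ k / 2 := fun h => (Finset.mem_erase.1 hi).1 (Fin.ext h)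
    rw [Function.update_of_ne (by simp only [ne_eq, Fin.ext_iff]; omega),
      Function.update_of_ne (by simp only [ne_eq, Fin.ext_iff]; omega)]
  rcases Nat.even_or_odd' (k : ℕ) with ⟨j, hj | hj⟩
  · have h0 : (⟨2 * ((k : ℕ) / 2), by omega⟩ : Fin (2 * m)) = k := Fin.ext (by simp only; omega)
    have h1 : (⟨2 * ((k : ℕ) / 2) + 1, by omega⟩ : Fin (2 * m)) ≠ k := by
      simp only [ne_eq, Fin.ext_iff]; omega
    refine ⟨(F ⟨(k : ℕ) / 2, hk⟩).flip (v ⟨2 * ((k : ℕ) / 2) + 1, by omega⟩), fun z => ?_⟩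
    rw [Function.update_of_ne h1, h0, Function.update_self, LinearMap.flip_apply]
  · have h0 : (⟨2 * ((k : ℕ) / 2), by omega⟩ : Fin (2 * m)) ≠ k := by
      simp only [ne_eq, Fin.ext_iff]; omega
    have h1 : (⟨2 * ((k : ℕ) / 2) + 1, by omega⟩ : Fin (2 * m)) = k :=
      Fin.ext (by simp only; omega)
    refine ⟨F ⟨(k : ℕ) / 2, hk⟩ (v ⟨2 * ((k : ℕ) / 2), by omega⟩), fun z => ?_⟩
    rw [Function.update_of_ne h0, h1, Function.update_self]

/-- The product of a family of bilinear forms evaluated on consecutive pairs of arguments. -/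
noncomputable def pairProd {R V : Type*} [CommRing R] [Algebra R ℂ] [AddCommGroup V] [Module R V]
    (m : ℕ) (F : Fin m → V →ₗ[R] V →ₗ[R] ℂ) :
    MultilinearMap R (fun _ : Fin (2 * m) => V) ℂ where
  toFun v := ∏ i : Fin m, F i (v ⟨2 * (i : ℕ), by omega⟩) (v ⟨2 * (i : ℕ) + 1, by omega⟩)
  map_update_add' v k x y := by
    obtain ⟨L, hL⟩ := exists_linearMap_prod_update m F v k
    simp only [hL, map_add]
  map_update_smul' v k c x := by
    obtain ⟨L, hL⟩ := exists_linearMap_prod_update m F v k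
    simp only [hL, map_smul]

theorem alternatization_pairProd {R V : Type*} [CommRing R] [Algebra R ℂ] [AddCommGroup V]
    [Module R V] (m : ℕ) (F : Fin m → V →ₗ[R] V →ₗ[R] ℂ) (v : Fin (2 * m) → V) :
    MultilinearMap.alternatization (pairProd m F) v = wedgePow m (fun i u w => F i u w) v := by
  rw [MultilinearMap.alternatization_apply, wedgePow]
  refine Finset.sum_congr rfl fun σ _ => ?_
  simp [pairProd, Units.smul_def]

/-- If `x ≠ 0` lies in the kernel of every `F i`, the top-degree wedge product vanishes. -/
theorem wedgePow_eq_zero_of_mem_ker {V : Type*} [AddCommGroup V] [Module ℝ V]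
    [FiniteDimensional ℝ V] (m : ℕ) (hdim : finrank ℝ V = 2 * m)
    (F : Fin m → V →ₗ[ℝ] V →ₗ[ℝ] ℂ) {x : V} (hx : x ≠ 0)
    (hl : ∀ i w, F i x w = 0) (hr : ∀ i w, F i w x = 0) :
    wedgePow m (fun i u w => F i u w) = 0 := by
  have hli : LinearIndepOn ℝ id ({x} : Set V) := LinearIndepOn.singleton hx
  let b := Basis.extend hli
  have hxb : x ∈ Set.range b := by
    rw [Basis.range_extend]
    exact hli.subset_extend _ rfl
  obtain ⟨j, hj⟩ := hxb
  have : Fintype (hli.extend (Set.subset_univ _)) := FiniteDimensional.fintypeBasisIndex b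
  have hcard : Fintype.card (Fin (2 * m)) = Fintype.card (hli.extend (Set.subset_univ _)) := by
    rw [Fintype.card_fin, ← hdim, finrank_eq_card_basis b]
  have h0 : MultilinearMap.alternatization (pairProd m F) = 0 := by
    refine Basis.ext_alternating b fun f hf => ?_
    obtain ⟨k, hk⟩ := ((Fintype.bijective_iff_injective_and_card f).2 ⟨hf, hcard⟩).2 j
    rw [alternatization_pairProd, wedgePow, AlternatingMap.zero_apply]
    refine Finset.sum_eq_zero fun σ _ => ?_
    have hlt : ((σ.symm k : Fin (2 * m)) : ℕ) / 2 < m := by omega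
    rw [Finset.prod_eq_zero (Finset.mem_univ ⟨_, hlt⟩), mul_zero]
    rcases Nat.even_or_odd' ((σ.symm k : Fin (2 * m)) : ℕ) with ⟨q, hq | hq⟩
    · have h : (⟨2 * (((σ.symm k : Fin (2 * m)) : ℕ) / 2), by omega⟩ : Fin (2 * m)) = σ.symm k :=
        Fin.ext (by simp only; omega)
      simp only [h, Equiv.apply_symm_apply, hk, hj, hl]
    · have h : (⟨2 * (((σ.symm k : Fin (2 * m)) : ℕ) / 2) + 1, by omega⟩ : Fin (2 * m)) =
          σ.symm k := Fin.ext (by simp only; omega)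
      simp only [h, Equiv.apply_symm_apply, hk, hj, hr]
  funext v
  rw [← alternatization_pairProd, h0]
  rfl

/-- The standard symplectic form on the index set of a symplectic basis. -/
def stdPairing {ι : Type*} [DecidableEq ι] (p q : ι × Fin 2) : ℤ :=
  if p.1 = q.1 then (if p.2 = q.2 then 0 else if p.2 = 0 then 1 else -1) else 0

theorem sign_mul_prod_stdPairing {ι : Type*} [Fintype ι] [DecidableEq ι]
    (π : Equiv.Perm (ι × Fin 2)) :
    (Equiv.Perm.sign π : ℤ) * ∏ i, stdPairing (π (i, 0)) (π (i, 1)) = 0 ∨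
    (Equiv.Perm.sign π : ℤ) * ∏ i, stdPairing (π (i, 0)) (π (i, 1)) = 1 := by
  by_cases h : ∃ i, stdPairing (π (i, 0)) (π (i, 1)) = 0
  · obtain ⟨i, hi⟩ := h
    left
    rw [Finset.prod_eq_zero (Finset.mem_univ i) hi, mul_zero]
  right
  push Not at h
  have hfst : ∀ i, (π (i, 0)).1 = (π (i, 1)).1 := by
    intro i
    by_contra hne
    exact h i (by simp [stdPairing, hne])
  have hsnd : ∀ i, (π (i, 0)).2 ≠ (π (i, 1)).2 := by
    intro i he
    exact h i (by simp [stdPairing, he])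
  have hinj : Function.Injective fun i => (π (i, 0)).1 := by
    intro i j hij
    simp only at hij
    have hc : (π (j, 0)).2 = (π (i, 0)).2 ∨ (π (j, 0)).2 = (π (i, 1)).2 := by
      have := hsnd i
      omega
    rcases hc with hc | hc
    · have := π.injective (Prod.ext hij.symm hc)
      exact (congrArg Prod.fst this).symm
    · have := π.injective (Prod.ext (hij.symm.trans (hfst i)) hc)
      exact (congrArg Prod.fst this).symm
  let τ : Equiv.Perm ι := Equiv.ofBijective _ (Finite.injective_iff_bijective.1 hinj)
  let f : ι → Equiv.Perm (Fin 2) := fun i => if (π (i, 0)).2 = 0 then 1 else Equiv.swap 0 1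
  have hπ : π = Equiv.prodCongrLeft (fun _ => τ) * Equiv.prodCongrRight f := by
    ext1 ⟨i, a⟩
    have h1 := hsnd i
    have h2 := hfst i
    have hτ : τ i = (π (i, 0)).1 := rfl
    by_cases h0 : (π (i, 0)).2 = 0
    · have h3 : (π (i, 1)).2 = 1 := by omega
      fin_cases a <;> simp [f, h0, Prod.ext_iff, hτ, h2, h3]
    · have h3 : (π (i, 1)).2 = 0 := by omega
      have h4 : (π (i, 0)).2 = 1 := by omega
      fin_cases a <;> simp [f, h4, Prod.ext_iff, hτ, h2, h3]
  have hsign : Equiv.Perm.sign π = ∏ i, Equiv.Perm.sign (f i) := by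
    conv_lhs => rw [hπ]
    rw [Equiv.Perm.sign_mul, Equiv.Perm.sign_prodCongrLeft, Equiv.Perm.sign_prodCongrRight]
    simp
  have hfac : ∀ i, stdPairing (π (i, 0)) (π (i, 1)) = (Equiv.Perm.sign (f i) : ℤ) := by
    intro i
    by_cases h0 : (π (i, 0)).2 = 0
    · have := hsnd i
      simp [stdPairing, hfst i, f, h0]
      omega
    · simp [stdPairing, hfst i, hsnd i, f, h0]
  simp only [hfac, hsign, Units.coe_prod]
  rw [← Finset.prod_mul_distrib]
  refine Finset.prod_eq_one fun i _ => ?_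
  rcases Int.units_eq_one_or (Equiv.Perm.sign (f i)) with h | h <;> simp [h]

theorem wedgePow_ne_zero_of_stdPairing {W : Type*} (m : ℕ) (B : W → W → ℂ)
    (s : Fin m × Fin 2 → W) (hs : ∀ p q, B (s p) (s q) = (stdPairing p q : ℂ)) :
    wedgePow m (fun _ => B) ≠ 0 := by
  let e : Fin m × Fin 2 ≃ Fin (2 * m) := finProdFinEquiv.trans (finCongr (mul_comm m 2))
  have he0 : ∀ i : Fin m, (⟨2 * (i : ℕ), by omega⟩ : Fin (2 * m)) = e (i, 0) := fun i =>
    Fin.ext (by simp [e])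
  have he1 : ∀ i : Fin m, (⟨2 * (i : ℕ) + 1, by omega⟩ : Fin (2 * m)) = e (i, 1) := fun i =>
    Fin.ext (by simp [e]; omega)
  let t : Equiv.Perm (Fin m × Fin 2) → ℤ := fun π =>
    (Equiv.Perm.sign π : ℤ) * ∏ i, stdPairing (π (i, 0)) (π (i, 1))
  have ht : ∀ π, 0 ≤ t π := fun π => by
    rcases sign_mul_prod_stdPairing π with h | h <;> simp only [t, h] <;> norm_num
  have hval : wedgePow m (fun _ => B) (s ∘ e.symm) =
      ((∑ σ : Equiv.Perm (Fin (2 * m)), t (e.symm.permCongr σ) : ℤ) : ℂ) := by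
    rw [wedgePow]
    push_cast
    refine Finset.sum_congr rfl fun σ _ => ?_
    simp only [t, Equiv.Perm.sign_permCongr, he0, he1, Function.comp_apply, hs]
    simp
  intro h
  rw [h, Pi.zero_apply] at hval
  have hpos : 0 < ∑ σ : Equiv.Perm (Fin (2 * m)), t (e.symm.permCongr σ) := by
    refine Finset.sum_pos' (fun σ _ => ht _) ⟨1, Finset.mem_univ _, ?_⟩
    simp [t, stdPairing]
  exact hpos.ne (by exact_mod_cast hval)

/-- An antisymmetric form of rank greater than `2 (m - 1)` admits `m` orthogonal hyperbolic
pairs. -/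
theorem exists_stdPairing_of_le_rank {W : Type*} [AddCommGroup W] [Module ℂ W]
    [FiniteDimensional ℂ W] (m : ℕ) :
    ∀ B : W →ₗ[ℂ] W →ₗ[ℂ] ℂ, (∀ x y, B x y = -B y x) →
      2 * m ≤ finrank ℂ (LinearMap.range B) + 1 →
      ∃ s : Fin m × Fin 2 → W, ∀ p q, B (s p) (s q) = (stdPairing p q : ℂ) := by
  induction m with
  | zero => exact fun B _ _ => ⟨fun p => p.1.elim0, fun p => p.1.elim0⟩
  | succ m ih =>
    intro B hB hrank
    have hself : ∀ x, B x x = 0 := fun x => self_eq_neg.1 (hB x x)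
    obtain ⟨u, w, huw⟩ : ∃ u w, B u w = 1 := by
      have hne : B ≠ 0 := by
        rintro rfl
        rw [LinearMap.range_zero, finrank_bot] at hrank
        omega
      obtain ⟨u, hu⟩ : ∃ u, B u ≠ 0 := by
        by_contra! h
        exact hne (LinearMap.ext h)
      obtain ⟨w, hw⟩ : ∃ w, B u w ≠ 0 := by
        by_contra! h
        exact hu (LinearMap.ext h)
      exact ⟨u, (B u w)⁻¹ • w, by simp [hw]⟩
    have hwu : B w u = -1 := by rw [hB, huw]
    let P : W →ₗ[ℂ] W := LinearMap.id - (B.flip w).smulRight u + (B.flip u).smulRight w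
    have hP : ∀ x, P x = x - B x w • u + B x u • w := fun x => rfl
    have hPu : ∀ x, B (P x) u = 0 := fun x => by simp [hP, hself, hwu]
    have hPw : ∀ x, B (P x) w = 0 := fun x => by simp [hP, hself, huw]
    have huP : ∀ x, B u (P x) = 0 := fun x => by rw [hB, hPu, neg_zero]
    have hwP : ∀ x, B w (P x) = 0 := fun x => by rw [hB, hPw, neg_zero]
    let B' : W →ₗ[ℂ] W →ₗ[ℂ] ℂ := B.compl₁₂ P P
    have hB' : ∀ x, B' x = B x - B x w • B u + B x u • B w := by
      intro x
      ext y
      have : B' x y = B (P x) y := by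
        change B (P x) (P y) = _
        rw [hP y]
        simp [hPu, hPw]
      rw [this, hP]
      simp
    have hle : LinearMap.range B ≤ LinearMap.range B' ⊔ Submodule.span ℂ {B u, B w} := by
      rintro _ ⟨x, rfl⟩
      have : B x = B' x + (B x w • B u + (-B x u) • B w) := by
        rw [hB']; module
      rw [this]
      refine Submodule.add_mem_sup ⟨x, rfl⟩ (Submodule.mem_span_pair.2 ⟨_, _, rfl⟩)
    have h1 := Submodule.finrank_mono hle
    have h2 := Submodule.finrank_add_le_finrank_add_finrank (LinearMap.range B')
      (Submodule.span ℂ {B u, B w})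
    have h3 : finrank ℂ (Submodule.span ℂ {B u, B w}) ≤ 2 := by
      classical
      have := finrank_span_finset_le_card (R := ℂ) ({B u, B w} : Finset (W →ₗ[ℂ] ℂ))
      rw [Finset.coe_pair] at this
      exact this.trans Finset.card_le_two
    obtain ⟨s, hs⟩ := ih B' (fun x y => hB _ _) (by omega)
    have hs' : ∀ p q, B (P (s p)) (P (s q)) = (stdPairing p q : ℂ) := hs
    refine ⟨fun p => Fin.cases (if p.2 = 0 then u else w) (fun i => P (s (i, p.2))) p.1, ?_⟩
    rintro ⟨i, a⟩ ⟨j, c⟩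
    refine Fin.cases ?_ (fun i => ?_) i <;> refine Fin.cases ?_ (fun j => ?_) j
    · fin_cases a <;> fin_cases c <;> simp [stdPairing, hself, huw, hwu]
    · fin_cases a <;> simp [stdPairing, huP, hwP, (Fin.succ_ne_zero _).symm]
    · fin_cases c <;> simp [stdPairing, hPu, hPw]
    · simp [hs', stdPairing]

/-- The complex bilinear extension, in coordinates, of a real bilinear complex-valued form. -/
noncomputable def complexExtension {V : Type*} [AddCommGroup V] [Module ℝ V] {N : ℕ}
    (b : Basis (Fin N) ℝ V) (Ω : V →ₗ[ℝ] V →ₗ[ℝ] ℂ) :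
    (Fin N → ℂ) →ₗ[ℂ] (Fin N → ℂ) →ₗ[ℂ] ℂ :=
  Matrix.toLinearMap₂' ℂ (Matrix.of fun i j => Ω (b i) (b j))

section complexExtension

variable {V : Type*} [AddCommGroup V] [Module ℝ V] {N : ℕ} (b : Basis (Fin N) ℝ V)
  (Ω : V →ₗ[ℝ] V →ₗ[ℝ] ℂ)

theorem complexExtension_single (i j : Fin N) :
    complexExtension b Ω (Pi.single i 1) (Pi.single j 1) = Ω (b i) (b j) := by
  simp [complexExtension, Matrix.toLinearMap₂'_apply']

theorem complexExtension_apply_single (z : Fin N → ℂ) (j : Fin N) :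
    complexExtension b Ω z (Pi.single j 1) = ∑ i, z i * Ω (b i) (b j) := by
  rw [← LinearMap.flip_apply, LinearMap.pi_apply_eq_sum_univ]
  refine Finset.sum_congr rfl fun i _ => ?_
  have : (fun k => if i = k then (1 : ℂ) else 0) = Pi.single i 1 := by
    ext k; simp [Pi.single_apply, eq_comm]
  rw [this, LinearMap.flip_apply, complexExtension_single, smul_eq_mul]

theorem complexExtension_repr_single (v : V) (j : Fin N) :
    complexExtension b Ω (fun i => (b.repr v i : ℂ)) (Pi.single j 1) = Ω v (b j) := by
  rw [complexExtension_apply_single]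
  conv_rhs => rw [← b.sum_repr v]
  simp only [map_sum, map_smul, LinearMap.sum_apply, LinearMap.smul_apply, Complex.real_smul]

theorem complexExtension_antisymm (halt : ∀ v, Ω v v = 0) (x y : Fin N → ℂ) :
    complexExtension b Ω x y = -complexExtension b Ω y x := by
  have h : complexExtension b Ω = -(complexExtension b Ω).flip := by
    refine LinearMap.ext_basis (Pi.basisFun ℂ _) (Pi.basisFun ℂ _) fun i j => ?_
    simp only [Pi.basisFun_apply, LinearMap.neg_apply, LinearMap.flip_apply,
      complexExtension_single]
    exact (LinearMap.IsAlt.neg (B := Ω) halt (b j) (b i)).symm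
  exact congrArg (fun f => f x y) h

theorem wedgePow_complexExtension (m : ℕ) (h : wedgePow m (fun _ u v => Ω u v) = 0) :
    wedgePow m (fun _ u v => complexExtension b Ω u v) = 0 := by
  have h0 : MultilinearMap.alternatization (pairProd m fun _ => complexExtension b Ω) = 0 := by
    refine Basis.ext_alternating (Pi.basisFun ℂ _) fun f _ => ?_
    rw [alternatization_pairProd]
    have := congrFun h (fun i => b (f i))
    simpa [wedgePow, complexExtension_single] using this
  funext v
  rw [← alternatization_pairProd, h0]
  rfl

theorem le_finrank_ker_complexExtension (halt : ∀ v, Ω v v = 0) (n : ℕ)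
    (hpow : wedgePow (n + 1) (fun _ u v => Ω u v) = 0) :
    N ≤ finrank ℂ (LinearMap.ker (complexExtension b Ω)) + 2 * n := by
  by_contra! hlt
  have hr := LinearMap.finrank_range_add_finrank_ker (complexExtension b Ω)
  rw [Module.finrank_fin_fun] at hr
  obtain ⟨s, hs⟩ := exists_stdPairing_of_le_rank (n + 1) (complexExtension b Ω)
    (complexExtension_antisymm b Ω halt) (by omega)
  exact wedgePow_ne_zero_of_stdPairing _ _ s hs (wedgePow_complexExtension b Ω _ hpow)

end complexExtension

/-- Pointwise complex conjugate of a complex-valued bilinear form. -/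
noncomputable def conjForm {V : Type*} [AddCommGroup V] [Module ℝ V]
    (Ω : V →ₗ[ℝ] V →ₗ[ℝ] ℂ) : V →ₗ[ℝ] V →ₗ[ℝ] ℂ :=
  Ω.compr₂ Complex.conjAe.toLinearMap

theorem conjForm_apply {V : Type*} [AddCommGroup V] [Module ℝ V]
    (Ω : V →ₗ[ℝ] V →ₗ[ℝ] ℂ) (u v : V) : conjForm Ω u v = (starRingEnd ℂ) (Ω u v) := rfl

theorem wedgePow_conjForm {V : Type*} [AddCommGroup V] [Module ℝ V]
    (Ω : V →ₗ[ℝ] V →ₗ[ℝ] ℂ) (m : ℕ) (h : wedgePow m (fun _ u v => Ω u v) = 0) :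
    wedgePow m (fun _ u v => conjForm Ω u v) = 0 := by
  funext v
  have := congrArg (starRingEnd ℂ) (congrFun h v)
  simpa [wedgePow, conjForm_apply] using this

/-- For a C-symplectic form, no nonzero real vector has `Ω v` proportional to its conjugate. -/
theorem eq_zero_of_eq_smul_conj {V : Type*} [AddCommGroup V] [Module ℝ V]
    [FiniteDimensional ℝ V] (n : ℕ) (hdim : finrank ℝ V = 4 * n)
    (Ω : V →ₗ[ℝ] V →ₗ[ℝ] ℂ) (halt : ∀ v : V, Ω v v = 0)
    (hpow : wedgePow (n + 1) (fun _ u v => Ω u v) = 0)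
    (hnz : wedgePow (2 * n)
      (fun i u v => if (i : ℕ) < n then Ω u v else (starRingEnd ℂ) (Ω u v)) ≠ 0)
    (c : ℂ) (v : V) (hv : ∀ w, Ω v w = c * (starRingEnd ℂ) (Ω v w)) : v = 0 := by
  have hker : ∀ x, (∀ w, Ω x w = 0) → x = 0 := by
    intro x hx
    by_contra hx0
    have hx' : ∀ w, Ω w x = 0 := fun w => by
      rw [← LinearMap.IsAlt.neg (B := Ω) halt x w, hx, neg_zero]
    have h0 := wedgePow_eq_zero_of_mem_ker (2 * n) (by omega)
      (fun i => if (i : ℕ) < n then Ω else conjForm Ω) hx0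
      (fun i w => by split_ifs <;> simp [conjForm_apply, hx])
      (fun i w => by split_ifs <;> simp [conjForm_apply, hx'])
    refine hnz (Eq.trans ?_ h0)
    congr 1
    funext i u w
    split_ifs <;> rfl
  let b : Basis (Fin (4 * n)) ℝ V := finBasisOfFinrankEq ℝ V hdim
  have hker' : ∀ x, (∀ j, Ω x (b j) = 0) → x = 0 := fun x hx =>
    hker x fun w => by
      have : Ω x = 0 := b.ext (by simpa using hx)
      simp [this]
  have halt' : ∀ v, conjForm Ω v v = 0 := fun v => by simp [conjForm_apply, halt]
  have hK := le_finrank_ker_complexExtension b Ω halt n hpow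
  have hK' := le_finrank_ker_complexExtension b (conjForm Ω) halt' n (wedgePow_conjForm Ω _ hpow)
  set K := LinearMap.ker (complexExtension b Ω)
  set K' := LinearMap.ker (complexExtension b (conjForm Ω))
  have hinf : K ⊓ K' = ⊥ := by
    rw [eq_bot_iff]
    rintro z ⟨hz, hz'⟩
    have e1 : ∀ j, ∑ i, z i * Ω (b i) (b j) = 0 := fun j => by
      rw [← complexExtension_apply_single, LinearMap.mem_ker.1 hz, LinearMap.zero_apply]
    have e2 : ∀ j, ∑ i, (starRingEnd ℂ) (z i) * Ω (b i) (b j) = 0 := fun j => by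
      have := congrArg (starRingEnd ℂ) (complexExtension_apply_single b (conjForm Ω) z j)
      rw [LinearMap.mem_ker.1 hz', LinearMap.zero_apply] at this
      simpa [conjForm_apply] using this.symm
    have hre : ∑ i, (z i).re • b i = 0 := hker' _ fun j => by
      have h : ∑ i, ((z i).re : ℂ) * Ω (b i) (b j) = 0 := by
        simp only [Complex.re_eq_add_conj, div_mul_eq_mul_div, add_mul, ← Finset.sum_div,
          Finset.sum_add_distrib, e1, e2, add_zero, zero_div]
      simpa only [map_sum, map_smul, LinearMap.sum_apply, LinearMap.smul_apply,
        Complex.real_smul] using h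
    have him : ∑ i, (z i).im • b i = 0 := hker' _ fun j => by
      have h : ∑ i, ((z i).im : ℂ) * Ω (b i) (b j) = 0 := by
        simp only [Complex.im_eq_sub_conj, div_mul_eq_mul_div, sub_mul, ← Finset.sum_div,
          Finset.sum_sub_distrib, e1, e2, sub_zero, zero_div]
      simpa only [map_sum, map_smul, LinearMap.sum_apply, LinearMap.smul_apply,
        Complex.real_smul] using h
    have hli := Fintype.linearIndependent_iff.1 b.linearIndependent
    funext i
    exact Complex.ext (hli _ hre i) (hli _ him i)
  have hsup : K ⊔ K' = ⊤ := by
    apply Submodule.eq_top_of_finrank_eq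
    have := Submodule.finrank_sup_add_finrank_inf_eq K K'
    rw [hinf, finrank_bot] at this
    have := Submodule.finrank_le (K ⊔ K')
    rw [finrank_fin_fun] at *
    omega
  refine hker' v fun j => ?_
  set x : Fin (4 * n) → ℂ := fun i => (b.repr v i : ℂ) with hx
  have hx' : complexExtension b Ω x = c • complexExtension b (conjForm Ω) x := by
    refine (Pi.basisFun ℂ _).ext fun j => ?_
    simp only [Pi.basisFun_apply, LinearMap.smul_apply, hx, complexExtension_repr_single,
      conjForm_apply, smul_eq_mul]
    exact hv _
  obtain ⟨k, hk, k', hk', hkk⟩ := Submodule.mem_sup.1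
    (hsup ▸ Submodule.mem_top : (Pi.single j 1 : Fin (4 * n) → ℂ) ∈ K ⊔ K')
  have h1 : complexExtension b Ω x k = 0 := by
    rw [complexExtension_antisymm b Ω halt, LinearMap.mem_ker.1 hk]; simp
  have h2 : complexExtension b Ω x k' = 0 := by
    rw [hx', LinearMap.smul_apply, complexExtension_antisymm b _ halt', LinearMap.mem_ker.1 hk']
    simp
  rw [← complexExtension_repr_single b, ← hkk, map_add]
  exact (congrArg₂ (· + ·) h1 h2).trans (add_zero 0)

/-- Let `V` be a real vector space of dimension `4n` and `Ω` an ℝ-bilinear alternating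
complex-valued form on `V` with `Ω^(n+1) = 0` and `Ω^n ∧ conj(Ω)^n ≠ 0` (C-symplectic).
Write `Ω = ω₁ + i·ω₂` with `ω₁, ω₂` real-valued. Then `ω₁` and `ω₂` are both
nondegenerate. -/
theorem stmt8 (n : ℕ) (hn : 1 ≤ n) (V : Type*) [AddCommGroup V] [Module ℝ V]
    [FiniteDimensional ℝ V] (hdim : finrank ℝ V = 4 * n)
    (Ω : V →ₗ[ℝ] V →ₗ[ℝ] ℂ) (halt : ∀ v : V, Ω v v = 0)
    (hpow : wedgePow (n + 1) (fun _ u v => Ω u v) = 0)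
    (hnz : wedgePow (2 * n)
      (fun i u v => if (i : ℕ) < n then Ω u v else (starRingEnd ℂ) (Ω u v)) ≠ 0)
    (ω₁ ω₂ : V →ₗ[ℝ] V →ₗ[ℝ] ℝ)
    (hdec : ∀ u v : V, Ω u v = (ω₁ u v : ℂ) + Complex.I * (ω₂ u v : ℂ)) :
    (∀ v : V, (∀ w : V, ω₁ v w = 0) → v = 0) ∧
    (∀ v : V, (∀ w : V, ω₂ v w = 0) → v = 0) := by
  have hconj : ∀ u v, (starRingEnd ℂ) (Ω u v) = (ω₁ u v : ℂ) - Complex.I * (ω₂ u v : ℂ) := by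
    intro u v
    rw [hdec]
    simp [sub_eq_add_neg]
  refine ⟨fun v hv => ?_, fun v hv => ?_⟩
  · refine eq_zero_of_eq_smul_conj n hdim Ω halt hpow hnz (-1) v fun w => ?_
    rw [hconj, hdec, hv]
    simp
  · refine eq_zero_of_eq_smul_conj n hdim Ω halt hpow hnz 1 v fun w => ?_
    rw [hconj, hdec, hv]
    simp
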